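/- Assume g satisfies conditions (2.4) and h satisfies conditions (2.5), and let N ≥ 1 be an integer. Given t₀ ≥ 0, let φ be the solution on its maximal interval (t₀, t₁) of the ODE (t^{N−1} g(φ(t)²) φ(t))' = t^{N−1} h(φ(t)²) with φ(t₀) = 0, and let ψ : (0,∞) → (t₀, t₁) be the inverse function of φ (which exists since φ is strictly increasing with range (0,∞)). Let Ω ⊂ ℝ^N be a bounded open set and let u be a C³ function on Ω, with u and ∇u continuous on the closure of Ω, solving Σ_{i=1}^N ∂_i(g(q²) ∂_i u) = h(q²) in Ω, where q = |∇u|, and with q(x) > 0 for all x in the closure of Ω. Then the function Φ(x) = ∫₀^{q(x)} s ψ'(s) ds − u(x) attains its maximum over the closure of Ω at a point of the boundary ∂Ω. -/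

import Mathlib

open Set Filter

noncomputable section

/-- `G(ξ) = g(ξ) + 2ξ g'(ξ)`, from (1.2). -/
def Gfun (g : ℝ → ℝ) (ξ : ℝ) : ℝ := g ξ + 2 * ξ * deriv g ξ

/-- Conditions (2.4) on `g`. -/
def Cond24 (g : ℝ → ℝ) : Prop :=
  ContDiffOn ℝ (⊤ : ℕ∞) g (Ioi 0) ∧ (∀ ξ > (0:ℝ), 0 < g ξ) ∧
  Tendsto (fun ξ : ℝ => g (ξ ^ 2) * ξ) (nhdsWithin 0 (Ioi 0)) (nhds 0) ∧
  Tendsto (fun ξ : ℝ => g (ξ ^ 2) * ξ) atTop atTop ∧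
  (∀ ξ > (0:ℝ), 0 < Gfun g ξ)

/-- Conditions (2.5) on `h`. -/
def Cond25 (h : ℝ → ℝ) : Prop :=
  ContDiffOn ℝ (⊤ : ℕ∞) h (Ici 0) ∧ (∀ ξ ≥ (0:ℝ), 0 < h ξ) ∧
  (∀ ξ ≥ (0:ℝ), 0 ≤ derivWithin h (Ici 0) ξ)

/-- `φ` is a (differentiable) solution of the ODE (2.6) on the set `s`. -/
def SolOn (N : ℕ) (g h φ : ℝ → ℝ) (s : Set ℝ) : Prop :=
  DifferentiableOn ℝ φ s ∧
  ∀ t ∈ s, HasDerivAt (fun τ : ℝ => τ ^ (N - 1) * (g (φ τ ^ 2) * φ τ))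
    (t ^ (N - 1) * h (φ t ^ 2)) t

/-- The open interval `(t₀, t₁)` where `t₁` may be `∞` (an extended real). -/
def Iint (t₀ : ℝ) (t₁ : EReal) : Set ℝ := {t : ℝ | t₀ < t ∧ (t : EReal) < t₁}

/-- The `i`-th standard basis vector of `ℝ^N`. -/
def eb (N : ℕ) (i : Fin N) : EuclideanSpace ℝ (Fin N) := EuclideanSpace.single i 1

open Topology

lemma second_deriv_nonpos_of_isLocalMax {f f' : ℝ → ℝ} {a c : ℝ} (hmax : IsLocalMax f a)
    (hf : ∀ᶠ t in 𝓝 a, HasDerivAt f (f' t) t) (hf' : HasDerivAt f' c a) : c ≤ 0 := by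
  by_contra! hc
  have hd : deriv f =ᶠ[𝓝 a] f' := hf.mono fun t ht => ht.deriv
  have hmin : IsLocalMin f a := by
    refine isLocalMin_of_deriv_deriv_pos ?_ hmax.deriv_eq_zero hf.self_of_nhds.continuousAt
    rwa [hd.deriv_eq, hf'.deriv]
  have hconst : f =ᶠ[𝓝 a] fun _ => f a := by
    filter_upwards [hmax, hmin] with t h1 h2 using le_antisymm h1 h2
  have hzero : deriv f =ᶠ[𝓝 a] fun _ => 0 := by
    simpa using hconst.deriv
  have h0 : deriv (deriv f) a = 0 := by
    rw [hzero.deriv_eq, deriv_const]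
  rw [hd.deriv_eq, hf'.deriv] at h0
  exact hc.ne' h0

section MaximumPrinciple

variable {ι E : Type*} [Fintype ι] [NormedAddCommGroup E] [InnerProductSpace ℝ E]

lemma inner_hessian_nonpos_of_isLocalMax {f : E → ℝ} {v : E → E} {W : E →L[ℝ] E}
    {x : E} (hmax : IsLocalMax f x) (hf : ∀ᶠ y in 𝓝 x, HasFDerivAt f (innerSL ℝ (v y)) y)
    (hv : HasFDerivAt v W x) (w : E) : inner ℝ (W w) w ≤ 0 := by
  have hline (t : ℝ) : HasDerivAt (fun t : ℝ => x + t • w) w t := by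
    simpa using ((hasDerivAt_id t).smul_const w).const_add x
  have hcont : Tendsto (fun t : ℝ => x + t • w) (𝓝 0) (𝓝 x) := by
    simpa using (hline 0).continuousAt.tendsto
  have h0 : x + (0 : ℝ) • w = x := by simp
  refine second_deriv_nonpos_of_isLocalMax (f := fun t : ℝ => f (x + t • w))
    (f' := fun t : ℝ => inner ℝ (v (x + t • w)) w) (a := 0) ?_ ?_ ?_
  · filter_upwards [hcont.eventually hmax] with t ht
    simpa using ht
  · filter_upwards [hcont.eventually hf] with t ht
    have h1 : HasDerivAt (fun t : ℝ => f (x + t • w)) (innerSL ℝ (v (x + t • w)) w) t :=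
      ht.comp_hasDerivAt t (hline t)
    simpa using h1
  · have h1 : HasDerivAt (fun t : ℝ => v (x + t • w)) (W w) 0 :=
      HasFDerivAt.comp_hasDerivAt (0 : ℝ) (by rwa [h0]) (hline 0)
    simpa using h1.inner ℝ (hasDerivAt_const (0 : ℝ) w)

lemma sum_inner_add_nonpos (b : OrthonormalBasis ι ℝ E) (B : E →L[ℝ] E)
    (hB : ∀ w, inner ℝ (B w) w ≤ 0) {c₁ c₂ : ℝ} (V : E) (h₁ : 0 < c₁)
    (h₂ : 0 < c₁ + c₂ * ‖V‖ ^ 2) :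
    c₁ * ∑ i, inner ℝ (B (b i)) (b i) + c₂ * inner ℝ (B V) V ≤ 0 := by
  obtain ⟨d, hd⟩ : ∃ d : ℝ, 2 * √c₁ * d + d ^ 2 * ‖V‖ ^ 2 = c₂ := by
    by_cases hV : ‖V‖ ^ 2 = 0
    · refine ⟨c₂ / (2 * √c₁), ?_⟩
      have : √c₁ ≠ 0 := (Real.sqrt_pos.2 h₁).ne'
      rw [hV]; field_simp; ring
    · refine ⟨(√(c₁ + c₂ * ‖V‖ ^ 2) - √c₁) / ‖V‖ ^ 2, ?_⟩
      have e1 := Real.sq_sqrt h₁.le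
      have e2 := Real.sq_sqrt h₂.le
      generalize √(c₁ + c₂ * ‖V‖ ^ 2) = r at *
      generalize √c₁ = s at *
      generalize ‖V‖ ^ 2 = ρ at *
      field_simp
      linear_combination e2 - e1
  have hs := Real.sq_sqrt h₁.le
  have key : ∑ i, inner ℝ (B (√c₁ • b i + (d * inner ℝ V (b i)) • V))
      (√c₁ • b i + (d * inner ℝ V (b i)) • V) =
      c₁ * ∑ i, inner ℝ (B (b i)) (b i) + c₂ * inner ℝ (B V) V := by
    have e1 : ∑ i, inner ℝ V (b i) * inner ℝ (b i) (B V) = inner ℝ V (B V) :=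
      b.sum_inner_mul_inner V (B V)
    have e2 : ∑ i, inner ℝ V (b i) * inner ℝ V (B (b i)) = inner ℝ V (B V) := by
      conv_rhs => rw [← b.sum_repr' V, map_sum, inner_sum]
      refine Finset.sum_congr rfl fun i _ => ?_
      rw [map_smul, inner_smul_right, b.sum_repr' V, real_inner_comm]
    have e3 : ∑ i, inner ℝ V (b i) * inner ℝ (b i) V = ‖V‖ ^ 2 := by
      rw [b.sum_inner_mul_inner, real_inner_self_eq_norm_sq]
    have expand (i : ι) : inner ℝ (B (√c₁ • b i + (d * inner ℝ V (b i)) • V))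
        (√c₁ • b i + (d * inner ℝ V (b i)) • V) =
        c₁ * inner ℝ (B (b i)) (b i)
        + √c₁ * d * (inner ℝ V (b i) * inner ℝ V (B (b i)))
        + √c₁ * d * (inner ℝ V (b i) * inner ℝ (b i) (B V))
        + d ^ 2 * inner ℝ (B V) V * (inner ℝ V (b i) * inner ℝ (b i) V) := by
      simp only [map_add, map_smul, inner_add_left, inner_add_right, inner_smul_left,
        inner_smul_right, conj_trivial]
      rw [real_inner_comm V (B (b i)), real_inner_comm (b i) (B V), real_inner_comm V (b i)]
      linear_combination inner ℝ (B (b i)) (b i) * hs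
    simp only [expand, Finset.sum_add_distrib, ← Finset.mul_sum, e1, e2, e3]
    rw [real_inner_comm V (B V)]
    linear_combination inner ℝ V (B V) * hd
  rw [← key]
  exact Finset.sum_nonpos fun i _ => hB _

theorem exists_frontier_forall_le_of_elliptic [FiniteDimensional ℝ E] [Nontrivial E]
    (b : OrthonormalBasis ι ℝ E) {Ω : Set E} (hΩ : IsOpen Ω) (hbdd : Bornology.IsBounded Ω)
    (hne : Ω.Nonempty) {P : E → ℝ} (hP : ContinuousOn P (closure Ω)) {v V : E → E}
    {W : E → E →L[ℝ] E} {c₁ c₂ β : E → ℝ}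
    (hPv : ∀ x ∈ Ω, HasFDerivAt P (innerSL ℝ (v x)) x)
    (hvW : ∀ x ∈ Ω, HasFDerivAt v (W x) x)
    (hV : ContinuousOn V Ω) (hc₁ : ContinuousOn c₁ Ω) (hc₂ : ContinuousOn c₂ Ω)
    (hβ : ContinuousOn β Ω) (hpos₁ : ∀ x ∈ Ω, 0 < c₁ x)
    (hpos₂ : ∀ x ∈ Ω, 0 < c₁ x + c₂ x * ‖V x‖ ^ 2)
    (hL : ∀ x ∈ Ω, -(β x * ‖v x‖) ≤
      c₁ x * ∑ i, inner ℝ (W x (b i)) (b i) + c₂ x * inner ℝ (W x (V x)) (V x)) :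
    ∃ x₀ ∈ frontier Ω, ∀ x ∈ closure Ω, P x ≤ P x₀ := by
  have hcpt : IsCompact (closure Ω) := hbdd.isCompact_closure
  obtain ⟨x₁, hx₁, hx₁max⟩ := hcpt.exists_isMaxOn hne.closure hP
  by_contra! hcon
  set M := P x₁ with hM
  have hlt : ∀ x ∈ frontier Ω, P x < M := fun x hx => by
    obtain ⟨y, hy, hxy⟩ := hcon x hx
    exact hxy.trans_le (hx₁max hy)
  have hlt' : ∀ x ∈ closure Ω, P x = M → x ∈ Ω := fun x hx hxM => by
    by_contra hxΩ
    exact (hlt x ⟨hx, by rwa [hΩ.interior_eq]⟩).ne hxM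
  have hSc : IsCompact (closure Ω ∩ P ⁻¹' {M}) :=
    hcpt.of_isClosed_subset (hP.preimage_isClosed_of_isClosed isClosed_closure isClosed_singleton)
      inter_subset_left
  obtain ⟨K, hK, hSK, hKΩ⟩ := exists_compact_between hSc hΩ
    (fun x hx => hlt' x hx.1 hx.2)
  have hKcl : K ⊆ closure Ω := hKΩ.trans subset_closure
  have hx₁K : x₁ ∈ interior K := hSK ⟨hx₁, rfl⟩
  obtain ⟨e, he⟩ := exists_norm_eq E (zero_le_one' ℝ)
  have hlam : ∀ x ∈ Ω, 0 < min (c₁ x) (c₁ x + c₂ x * ‖V x‖ ^ 2) := fun x hx =>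
    lt_min (hpos₁ x hx) (hpos₂ x hx)
  have hquot : ContinuousOn (fun x => β x / min (c₁ x) (c₁ x + c₂ x * ‖V x‖ ^ 2)) K :=
    (hβ.div (hc₁.inf (hc₁.add (hc₂.mul (hV.norm.pow 2)))) fun x hx => (hlam x hx).ne').mono hKΩ
  obtain ⟨γ₀, hγ₀⟩ := (hK.image_of_continuousOn hquot).bddAbove
  set γ := max γ₀ 0 + 1 with hγdef
  have hγpos : 0 < γ := by positivity
  have hγ : ∀ x ∈ K, β x < γ * min (c₁ x) (c₁ x + c₂ x * ‖V x‖ ^ 2) := fun x hx => by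
    rw [← div_lt_iff₀ (hlam x (hKΩ hx))]
    have h1 := hγ₀ (mem_image_of_mem _ hx)
    have h2 := le_max_left γ₀ 0
    linarith
  set ex : E → ℝ := fun x => Real.exp (γ * inner ℝ e x) with hex
  have hexc : Continuous ex := by fun_prop
  have hfrK : IsCompact (K \ interior K) := hK.diff isOpen_interior
  obtain ⟨ε, hε, hεlt⟩ : ∃ ε > 0, ∀ x ∈ K \ interior K, P x + ε * ex x < M := by
    rcases (K \ interior K).eq_empty_or_nonempty with h | h
    · exact ⟨1, one_pos, by simp [h]⟩
    obtain ⟨y, hy, hymax⟩ := hfrK.exists_isMaxOn h (hP.mono (sdiff_subset.trans hKcl))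
    obtain ⟨z, hz, hzmax⟩ := hfrK.exists_isMaxOn h hexc.continuousOn
    have hPy : P y < M := by
      refine lt_of_le_of_ne (hx₁max (hKcl hy.1)) fun hyM => hy.2 (hSK ⟨hKcl hy.1, hyM⟩)
    have hzpos : 0 < ex z := Real.exp_pos _
    refine ⟨(M - P y) / (2 * ex z), by have := sub_pos.2 hPy; positivity, fun x hx => ?_⟩
    have h1 : P x ≤ P y := hymax hx
    have h2 : ex x ≤ ex z := hzmax hx
    calc P x + (M - P y) / (2 * ex z) * ex x ≤ P y + (M - P y) / (2 * ex z) * ex z := by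
          have := sub_pos.2 hPy
          gcongr
      _ = (P y + M) / 2 := by field_simp; ring
      _ < M := by linarith
  obtain ⟨x, hx, hxmax⟩ := hK.exists_isMaxOn ⟨x₁, interior_subset hx₁K⟩
    ((hP.mono hKcl).add (hexc.continuousOn.const_smul ε))
  have hxint : x ∈ interior K := by
    by_contra hxn
    have h1 := hεlt x ⟨hx, hxn⟩
    have h2 : P x₁ + ε * ex x₁ ≤ P x + ε * ex x := hxmax (interior_subset hx₁K)
    have h3 : 0 < ε * ex x₁ := mul_pos hε (Real.exp_pos _)
    linarith
  have hxΩ : x ∈ Ω := hKΩ hx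
  have hloc : IsLocalMax (fun y => P y + ε * ex y) x :=
    hxmax.isLocalMax (mem_interior_iff_mem_nhds.1 hxint)
  have hlin (y : E) : HasFDerivAt (fun y => γ * inner ℝ e y) (γ • innerSL ℝ e) y :=
    ((innerSL ℝ e).hasFDerivAt (x := y)).const_mul γ
  have hexd (y : E) : HasFDerivAt ex (ex y • γ • innerSL ℝ e) y := (hlin y).exp
  have hQ : ∀ y ∈ Ω, HasFDerivAt (fun y => P y + ε * ex y)
      (innerSL ℝ (v y + (ε * ex y * γ) • e)) y := fun y hy => by
    refine ((hPv y hy).add ((hexd y).const_mul ε)).congr_fderiv ?_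
    ext w
    simp
    ring
  have hQ' : HasFDerivAt (fun y => v y + (ε * ex y * γ) • e)
      (W x + ((γ * ε) • ex x • γ • innerSL ℝ e).smulRight e) x := by
    refine (hvW x hxΩ).add ?_
    have := ((hexd x).const_mul (γ * ε)).smul_const e
    refine this.congr_of_eventuallyEq (Eventually.of_forall fun y => ?_)
    simp only
    congr 1
    ring
  have hB := inner_hessian_nonpos_of_isLocalMax hloc
    (by filter_upwards [hΩ.mem_nhds hxΩ] with y hy using hQ y hy) hQ'
  have hgrad : v x + (ε * ex x * γ) • e = 0 := by
    have h0 := hloc.hasFDerivAt_eq_zero (hQ x hxΩ)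
    rw [← inner_self_eq_zero (𝕜 := ℝ), ← innerSL_apply_apply ℝ, h0]
    simp
  have hexpos : 0 < ε * ex x * γ := by have := Real.exp_pos (γ * inner ℝ e x); positivity
  have hvnorm : ‖v x‖ = ε * ex x * γ := by
    rw [eq_neg_of_add_eq_zero_left hgrad, norm_neg, norm_smul, he, mul_one,
      Real.norm_of_nonneg hexpos.le]
  have hle := sum_inner_add_nonpos b _ hB (V x) (hpos₁ x hxΩ) (hpos₂ x hxΩ)
  have hsum : ∑ i, inner ℝ e (b i) * inner ℝ e (b i) = 1 := by
    have := b.sum_inner_mul_inner e e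
    rw [real_inner_self_eq_norm_sq, he] at this
    simpa [real_inner_comm e] using this
  have hLx := hL x hxΩ
  simp only [add_apply, ContinuousLinearMap.smulRight_apply,
    smul_apply, innerSL_apply_apply, inner_add_left, inner_smul_left,
    conj_trivial, smul_eq_mul, Finset.sum_add_distrib] at hle
  have hsum' : ∑ i, γ * ε * (ex x * (γ * inner ℝ e (b i))) * inner ℝ e (b i) =
      γ * ε * (ex x * γ) := by
    rw [← mul_one (γ * ε * (ex x * γ)), ← hsum, Finset.mul_sum]
    exact Finset.sum_congr rfl fun i _ => by ring
  rw [hsum'] at hle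
  have hγx := hγ x hx
  have hcs : min (c₁ x) (c₁ x + c₂ x * ‖V x‖ ^ 2) ≤ c₁ x + c₂ x * inner ℝ e (V x) ^ 2 := by
    have h1 : inner ℝ e (V x) ^ 2 ≤ ‖V x‖ ^ 2 := by
      have := abs_real_inner_le_norm e (V x)
      rw [he, one_mul] at this
      exact sq_le_sq.2 (by rwa [abs_of_nonneg (norm_nonneg (V x))])
    rcases le_total 0 (c₂ x) with h | h
    · exact (min_le_left _ _).trans (by nlinarith [sq_nonneg (inner ℝ e (V x))])
    · exact (min_le_right _ _).trans (by nlinarith)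
  rw [hvnorm] at hLx
  have h1 := hγx.trans_le (mul_le_mul_of_nonneg_left hcs hγpos.le)
  have h2 := mul_lt_mul_of_pos_left h1 hexpos
  linarith

end MaximumPrinciple

section EllipticInequality

variable {ι E : Type*} [Fintype ι] [NormedAddCommGroup E] [InnerProductSpace ℝ E]

lemma le_sum_norm_sq_of_isSymmetric (b : OrthonormalBasis ι ℝ E) (H : E →L[ℝ] E) (V : E)
    (hH : ∀ w w', inner ℝ (H w) w' = inner ℝ w (H w')) (α β : ℝ) :
    2 * α * ∑ i, inner ℝ (H (b i)) (b i) + 2 * β * inner ℝ V (H V)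
      - (Fintype.card ι * α ^ 2 + 2 * α * β * ‖V‖ ^ 2 + β ^ 2 * (‖V‖ ^ 2) ^ 2)
      ≤ ∑ i, ‖H (b i)‖ ^ 2 := by
  have e1 : ∑ i, inner ℝ V (b i) * inner ℝ (b i) (H V) = inner ℝ V (H V) :=
    b.sum_inner_mul_inner V (H V)
  have e3 : ∑ i, inner ℝ V (b i) * inner ℝ (b i) V = ‖V‖ ^ 2 := by
    rw [b.sum_inner_mul_inner, real_inner_self_eq_norm_sq]
  have expand (i : ι) : ‖H (b i) - (α • b i + (β * inner ℝ V (b i)) • V)‖ ^ 2 =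
      ‖H (b i)‖ ^ 2 - 2 * α * inner ℝ (H (b i)) (b i)
      - 2 * β * (inner ℝ V (b i) * inner ℝ (b i) (H V)) + α ^ 2
      + (2 * α * β + β ^ 2 * ‖V‖ ^ 2) * (inner ℝ V (b i) * inner ℝ (b i) V) := by
    rw [norm_sub_sq_real, norm_add_sq_real]
    simp only [inner_add_right, inner_smul_left, inner_smul_right, norm_smul, conj_trivial,
      b.norm_eq_one, mul_pow, Real.norm_eq_abs, sq_abs]
    rw [hH (b i) V, real_inner_comm V (b i)]
    ring
  have hnonneg : 0 ≤ ∑ i, ‖H (b i) - (α • b i + (β * inner ℝ V (b i)) • V)‖ ^ 2 :=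
    Finset.sum_nonneg fun i _ => by positivity
  simp only [expand, Finset.sum_add_distrib, Finset.sum_sub_distrib, ← Finset.mul_sum, e1, e3,
    Finset.sum_const, Finset.card_univ, nsmul_eq_mul] at hnonneg
  linarith

/-- The radial case of equality in the differential inequality for the `P`-function. -/
lemma radial_identity {g g' g'' h h' m m' α α' ρ n : ℝ} (hg : g ≠ 0) (hm : m ≠ 0) (hρ : ρ ≠ 0)
    (hα' : α' = α / (2 * ρ) - m * α ^ 2 / (2 * ρ))
    (hode : m * (h - n * (g * α)) = g + 2 * ρ * g')
    (hode' : m' * (h - n * (g * α)) + m * (h' - n * (g' * α + g * α')) = 3 * g' + 2 * ρ * g'') :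
    (2 * m' * g - 2 * m * g') * (ρ / m ^ 2)
      + (4 * m' * g' - 4 * m * g'' + 4 * m * g' ^ 2 / g) * (ρ / m) ^ 2
      + (2 * m * g * ((1 / m - α) / ρ) + 2 * m * h' - 4 * m * α * g' - 2 * m * g' * h / g)
        * (ρ / m)
      + (2 * m * α * h - m * g * ((n + 1) * α ^ 2 + 2 * α * ((1 / m - α) / ρ) * ρ
        + ((1 / m - α) / ρ) ^ 2 * ρ ^ 2) - h) = 0 := by
  subst hα'
  linear_combination (norm := (field_simp; ring))
    (2 * α - 2 * m' * ρ / m ^ 2 - (g + 2 * ρ * g') / (g * m)) * hode + 2 * ρ / m * hode'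

/-- The differential inequality satisfied by the `P`-function: `v` is its gradient, and
`g I + 2 g' V ⊗ V` contracted with its Hessian is bounded below by a term linear in `v`. -/
lemma elliptic_inequality (b : OrthonormalBasis ι ℝ E) {V v : E} {H W : E →L[ℝ] E}
    {T : E →L[ℝ] E →L[ℝ] E} {g g' g'' h h' m m' α α' n : ℝ}
    (hH : ∀ w w', inner ℝ (H w) w' = inner ℝ w (H w'))
    (hT : ∀ w w', T w w' = T w' w)
    (hv : v = m • H V - V)
    (hW : ∀ w, W w = (2 * m' * inner ℝ V (H w)) • H V + m • (T w V + H (H w)) - H w)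
    (hn : (Fintype.card ι : ℝ) = n + 1) (hg : 0 < g) (hm : 0 < m) (hV : V ≠ 0)
    (hα' : α' = α / (2 * ‖V‖ ^ 2) - m * α ^ 2 / (2 * ‖V‖ ^ 2))
    (hode : m * (h - n * (g * α)) = g + 2 * ‖V‖ ^ 2 * g')
    (hode' : m' * (h - n * (g * α)) + m * (h' - n * (g' * α + g * α'))
      = 3 * g' + 2 * ‖V‖ ^ 2 * g'')
    (hpde : 2 * g' * inner ℝ V (H V) + g * ∑ i, inner ℝ (H (b i)) (b i) = h)
    (hpde' : 4 * g'' * inner ℝ V (H V) ^ 2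
      + 2 * g' * (2 * ‖H V‖ ^ 2 + inner ℝ V (T V V))
      + 2 * g' * inner ℝ V (H V) * ∑ i, inner ℝ (H (b i)) (b i)
      + g * ∑ i, inner ℝ (T V (b i)) (b i) = 2 * h' * inner ℝ V (H V)) :
    (2 * m' * g - 2 * m * g') * ((2 * inner ℝ V v + ‖v‖ ^ 2) / m ^ 2)
      + (4 * m' * g' - 4 * m * g'' + 4 * m * g' ^ 2 / g)
        * ((2 * ‖V‖ ^ 2 * inner ℝ V v + inner ℝ V v ^ 2) / m ^ 2)
      + (2 * m * g * ((1 / m - α) / ‖V‖ ^ 2) + 2 * m * h' - 4 * m * α * g' - 2 * m * g' * h / g)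
        * (inner ℝ V v / m)
      ≤ g * ∑ i, inner ℝ (W (b i)) (b i) + 2 * g' * inner ℝ (W V) V := by
  have hρ : ‖V‖ ^ 2 ≠ 0 := by positivity
  have hκ : inner ℝ V (H V) = (‖V‖ ^ 2 + inner ℝ V v) / m := by
    rw [hv, inner_sub_right, inner_smul_right, real_inner_self_eq_norm_sq]
    field_simp
    ring
  have hη : ‖H V‖ ^ 2 = (‖V‖ ^ 2 + 2 * inner ℝ V v + ‖v‖ ^ 2) / m ^ 2 := by
    have h1 : m • H V = V + v := by rw [hv]; abel
    have h2 : ‖m • H V‖ ^ 2 = ‖V + v‖ ^ 2 := by rw [h1]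
    rw [norm_add_sq_real, norm_smul, mul_pow, Real.norm_eq_abs, sq_abs] at h2
    field_simp
    linarith
  have hsq := le_sum_norm_sq_of_isSymmetric b H V hH α ((1 / m - α) / ‖V‖ ^ 2)
  have hWV : inner ℝ (W V) V = 2 * m' * inner ℝ V (H V) ^ 2 + m * (inner ℝ V (T V V) + ‖H V‖ ^ 2)
      - inner ℝ V (H V) := by
    rw [hW]
    simp only [inner_add_left, inner_sub_left, inner_smul_left, conj_trivial]
    rw [hH (H V) V, real_inner_self_eq_norm_sq, real_inner_comm V (T V V), real_inner_comm V (H V)]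
    ring
  have hWb : ∑ i, inner ℝ (W (b i)) (b i) = 2 * m' * ‖H V‖ ^ 2
      + m * (∑ i, inner ℝ (T V (b i)) (b i) + ∑ i, ‖H (b i)‖ ^ 2)
      - ∑ i, inner ℝ (H (b i)) (b i) := by
    have e1 : ∑ i, inner ℝ (H V) (b i) * inner ℝ (b i) (H V) = ‖H V‖ ^ 2 := by
      rw [b.sum_inner_mul_inner, real_inner_self_eq_norm_sq]
    have expand (i : ι) : inner ℝ (W (b i)) (b i) =
        2 * m' * (inner ℝ (H V) (b i) * inner ℝ (b i) (H V))
        + m * (inner ℝ (T V (b i)) (b i) + ‖H (b i)‖ ^ 2) - inner ℝ (H (b i)) (b i) := by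
      rw [hW]
      simp only [inner_add_left, inner_sub_left, inner_smul_left, conj_trivial]
      rw [hH (H (b i)) (b i), real_inner_self_eq_norm_sq, hT (b i) V, ← hH V (b i),
        real_inner_comm (H V) (b i)]
      ring
    simp only [expand, Finset.sum_add_distrib, Finset.sum_sub_distrib, ← Finset.mul_sum, e1]
  have hΔ : ∑ i, inner ℝ (H (b i)) (b i) = (h - 2 * g' * inner ℝ V (H V)) / g := by
    field_simp
    linarith
  have hrad := radial_identity hg.ne' hm.ne' hρ hα' hode hode'
  have hsq' := mul_le_mul_of_nonneg_left hsq (mul_pos hm hg).le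
  rw [hn] at hsq'
  rw [hWV, hWb]
  refine le_of_eq_of_le ?_ (le_of_sub_nonneg (b :=
    g * (2 * m' * ‖H V‖ ^ 2 + m * ∑ i, inner ℝ (T V (b i)) (b i)
      - ∑ i, inner ℝ (H (b i)) (b i)) +
    m * g * (2 * α * ∑ i, inner ℝ (H (b i)) (b i) + 2 * ((1 / m - α) / ‖V‖ ^ 2) * inner ℝ V (H V)
      - ((n + 1) * α ^ 2 + 2 * α * ((1 / m - α) / ‖V‖ ^ 2) * ‖V‖ ^ 2
      + ((1 / m - α) / ‖V‖ ^ 2) ^ 2 * (‖V‖ ^ 2) ^ 2))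
    + 2 * g' * (2 * m' * inner ℝ V (H V) ^ 2 + m * (inner ℝ V (T V V) + ‖H V‖ ^ 2)
      - inner ℝ V (H V))) ?_)
  · generalize ∑ i, inner ℝ (T V (b i)) (b i) = τ at *
    rw [hΔ, hη, hκ] at hpde' ⊢
    linear_combination (norm := (field_simp; ring)) -m * hpde' - hrad
  · linarith

end EllipticInequality

section RadialProfile

lemma Cond24.hasDerivAt {g : ℝ → ℝ} (hg : Cond24 g) {ξ : ℝ} (hξ : 0 < ξ) :
    HasDerivAt g (deriv g ξ) ξ :=
  ((hg.1.contDiffAt (Ioi_mem_nhds hξ)).differentiableAt (by simp)).hasDerivAt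

lemma Cond25.hasDerivAt {h : ℝ → ℝ} (hh : Cond25 h) {ξ : ℝ} (hξ : 0 < ξ) :
    HasDerivAt h (deriv h ξ) ξ :=
  ((hh.1.contDiffAt (Ici_mem_nhds hξ)).differentiableAt (by simp)).hasDerivAt

lemma Cond25.monotoneOn {h : ℝ → ℝ} (hh : Cond25 h) : MonotoneOn h (Ici 0) := by
  refine monotoneOn_of_deriv_nonneg (convex_Ici 0) hh.1.continuousOn ?_ ?_
  · exact (hh.1.differentiableOn (by simp)).mono interior_subset
  · intro x hx
    rw [interior_Ici] at hx
    rw [← derivWithin_of_mem_nhds (Ici_mem_nhds hx)]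
    exact hh.2.2 x (le_of_lt hx)

lemma Cond24.hasDerivAt_flux {g : ℝ → ℝ} (hg : Cond24 g) {s : ℝ} (hs : 0 < s) :
    HasDerivAt (fun s => g (s ^ 2) * s) (Gfun g (s ^ 2)) s := by
  have h1 : HasDerivAt (fun s : ℝ => g (s ^ 2)) (deriv g (s ^ 2) * (2 * s)) s := by
    have hsq : HasDerivAt (fun s : ℝ => s ^ 2) (2 * s) s := by simpa using hasDerivAt_pow 2 s
    exact HasDerivAt.comp (h₂ := g) (h := fun s => s ^ 2) s (hg.hasDerivAt (by positivity)) hsq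
  refine (h1.mul (hasDerivAt_id s)).congr_deriv ?_
  simp [Gfun]
  ring

lemma isOpen_Iint (t₀ : ℝ) (t₁ : EReal) : IsOpen (Iint t₀ t₁) :=
  isOpen_Ioi.inter (isOpen_Iio.preimage continuous_coe_real_ereal)

variable {N : ℕ} {g h φ ψ : ℝ → ℝ} {t₀ : ℝ} {t₁ : EReal}

lemma SolOn.pow_mul_flux_le (hg : Cond24 g) (hh : Cond25 h) (ht₀ : 0 ≤ t₀)
    (hsol : SolOn N g h φ (Iint t₀ t₁)) (hcont₀ : Tendsto φ (𝓝[>] t₀) (𝓝 0))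
    (hmono : StrictMonoOn φ (Iint t₀ t₁)) (hpos : ∀ t ∈ Iint t₀ t₁, 0 < φ t)
    {t : ℝ} (ht : t ∈ Iint t₀ t₁) :
    t ^ (N - 1) * (g (φ t ^ 2) * φ t) ≤
      h (φ t ^ 2) * (t ^ (N - 1 + 1) / ((N - 1 : ℕ) + 1)) := by
  set n := N - 1
  have hsub : Ioc t₀ t ⊆ Iint t₀ t₁ := fun τ hτ =>
    ⟨hτ.1, (EReal.coe_le_coe_iff.2 hτ.2).trans_lt ht.2⟩
  set D : ℝ → ℝ := fun τ =>
    h (φ t ^ 2) * (τ ^ (n + 1) / ((n : ℝ) + 1)) - τ ^ n * (g (φ τ ^ 2) * φ τ) with hD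
  have hn : (n : ℝ) + 1 ≠ 0 := by positivity
  have hDd : ∀ τ ∈ Ioc t₀ t, HasDerivAt D
      (h (φ t ^ 2) * τ ^ n - τ ^ n * h (φ τ ^ 2)) τ := fun τ hτ => by
    refine HasDerivAt.sub ?_ (hsol.2 τ (hsub hτ))
    refine (((hasDerivAt_pow (n + 1) τ).div_const ((n : ℝ) + 1)).const_mul _).congr_deriv ?_
    rw [Nat.add_sub_cancel]
    push_cast
    field_simp
  have hDm : MonotoneOn D (Ioc t₀ t) := by
    refine monotoneOn_of_deriv_nonneg (convex_Ioc t₀ t)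
      (fun τ hτ => (hDd τ hτ).continuousAt.continuousWithinAt)
      (fun τ hτ => (hDd τ (interior_subset hτ)).differentiableAt.differentiableWithinAt)
      fun τ hτ => ?_
    have hτ' := interior_subset hτ
    rw [(hDd τ hτ').deriv]
    have h1 : φ τ ≤ φ t := hmono.monotoneOn (hsub hτ') ht hτ'.2
    have h2 := hpos τ (hsub hτ')
    have h3 : h (φ τ ^ 2) ≤ h (φ t ^ 2) :=
      hh.monotoneOn (mem_Ici.2 (sq_nonneg _)) (mem_Ici.2 (sq_nonneg _)) (by gcongr)
    have h4 : 0 ≤ τ ^ n := pow_nonneg (ht₀.trans hτ'.1.le) n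
    nlinarith
  have hflux : Tendsto (fun τ => g (φ τ ^ 2) * φ τ) (𝓝[>] t₀) (𝓝 0) := by
    refine hg.2.2.1.comp (tendsto_nhdsWithin_iff.2 ⟨hcont₀, ?_⟩)
    filter_upwards [Ioc_mem_nhdsGT ht.1] with τ hτ using hpos τ (hsub hτ)
  have hpow (k : ℕ) : Tendsto (fun τ : ℝ => τ ^ k) (𝓝[>] t₀) (𝓝 (t₀ ^ k)) :=
    (continuous_pow k).continuousWithinAt
  have hlim : Tendsto D (𝓝[>] t₀)
      (𝓝 (h (φ t ^ 2) * (t₀ ^ (n + 1) / ((n : ℝ) + 1)) - t₀ ^ n * 0)) :=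
    (((hpow (n + 1)).div_const _).const_mul _).sub ((hpow n).mul hflux)
  have hle : h (φ t ^ 2) * (t₀ ^ (n + 1) / ((n : ℝ) + 1)) - t₀ ^ n * 0 ≤ D t := by
    refine le_of_tendsto hlim ?_
    filter_upwards [Ioc_mem_nhdsGT ht.1] with τ hτ using hDm hτ ⟨ht.1, le_rfl⟩ hτ.2
  have h0 : 0 ≤ h (φ t ^ 2) * (t₀ ^ (n + 1) / ((n : ℝ) + 1)) := by
    have := hh.2.1 (φ t ^ 2) (sq_nonneg _)
    positivity
  simp only [hD] at hle
  linarith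

lemma SolOn.mul_flux_lt (hg : Cond24 g) (hh : Cond25 h) (ht₀ : 0 ≤ t₀)
    (hsol : SolOn N g h φ (Iint t₀ t₁)) (hcont₀ : Tendsto φ (𝓝[>] t₀) (𝓝 0))
    (hmono : StrictMonoOn φ (Iint t₀ t₁)) (hpos : ∀ t ∈ Iint t₀ t₁, 0 < φ t)
    {t : ℝ} (ht : t ∈ Iint t₀ t₁) :
    (N - 1 : ℕ) * (g (φ t ^ 2) * (φ t / t)) < h (φ t ^ 2) := by
  have h1 := hsol.pow_mul_flux_le hg hh ht₀ hcont₀ hmono hpos ht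
  have htpos : 0 < t := ht₀.trans_lt ht.1
  have hhpos := hh.2.1 (φ t ^ 2) (sq_nonneg _)
  generalize N - 1 = n at *
  rw [pow_succ t n, mul_div_assoc, mul_left_comm (h _)] at h1
  replace h1 := le_of_mul_le_mul_left h1 (by positivity)
  calc (n : ℝ) * (g (φ t ^ 2) * (φ t / t)) = n / t * (g (φ t ^ 2) * φ t) := by ring
    _ ≤ n / t * (h (φ t ^ 2) * (t / (n + 1))) := by gcongr
    _ = h (φ t ^ 2) - h (φ t ^ 2) / (n + 1) := by field_simp; ring
    _ < h (φ t ^ 2) := by have : 0 < h (φ t ^ 2) / (n + 1) := by positivity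
                          linarith

lemma SolOn.Gfun_mul_deriv (hg : Cond24 g) (ht₀ : 0 ≤ t₀)
    (hsol : SolOn N g h φ (Iint t₀ t₁)) (hpos : ∀ t ∈ Iint t₀ t₁, 0 < φ t)
    {t : ℝ} (ht : t ∈ Iint t₀ t₁) :
    Gfun g (φ t ^ 2) * deriv φ t =
      h (φ t ^ 2) - (N - 1 : ℕ) * (g (φ t ^ 2) * (φ t / t)) := by
  have htpos : 0 < t := ht₀.trans_lt ht.1
  have hφ : HasDerivAt φ (deriv φ t) t :=
    (hsol.1.differentiableAt ((isOpen_Iint t₀ t₁).mem_nhds ht)).hasDerivAt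
  have h1 := (hasDerivAt_pow (N - 1) t).mul ((hg.hasDerivAt_flux (hpos t ht)).comp t hφ)
  have h2 := h1.unique (hsol.2 t ht)
  simp only [Function.comp] at h2
  generalize N - 1 = n at *
  rcases n with _ | n
  · simp at h2 ⊢
    linarith
  · have h3 : t ^ n ≠ 0 := by positivity
    rw [Nat.add_sub_cancel, pow_succ t n] at h2
    have h4 : t ^ n * (((n + 1 : ℕ) : ℝ) * (g (φ t ^ 2) * φ t)
        + t * (Gfun g (φ t ^ 2) * deriv φ t)) = t ^ n * (t * h (φ t ^ 2)) := by
      linear_combination h2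
    have h5 := mul_left_cancel₀ h3 h4
    field_simp
    linarith

/-- The facts about the inverse `ψ` of a radial solution that determine `ψ'`. -/
lemma SolOn.inverse_properties (hg : Cond24 g) (hh : Cond25 h) (ht₀ : 0 ≤ t₀)
    (hsol : SolOn N g h φ (Iint t₀ t₁)) (hcont₀ : Tendsto φ (𝓝[>] t₀) (𝓝 0))
    (hmono : StrictMonoOn φ (Iint t₀ t₁)) (hrange : φ '' Iint t₀ t₁ = Ioi 0)
    (hψl : ∀ t ∈ Iint t₀ t₁, ψ (φ t) = t)
    (hψr : ∀ s ∈ Ioi (0 : ℝ), ψ s ∈ Iint t₀ t₁ ∧ φ (ψ s) = s) :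
    StrictMonoOn ψ (Ioi 0) ∧ ∀ s ∈ Ioi (0 : ℝ), 0 < deriv ψ s ∧ HasDerivAt ψ (deriv ψ s) s ∧
      0 < h (s ^ 2) - (N - 1 : ℕ) * (g (s ^ 2) * (s / ψ s)) ∧
      deriv ψ s * (h (s ^ 2) - (N - 1 : ℕ) * (g (s ^ 2) * (s / ψ s))) = Gfun g (s ^ 2) := by
  have hpos : ∀ t ∈ Iint t₀ t₁, 0 < φ t := fun t ht => by
    have := mem_image_of_mem φ ht
    rwa [hrange] at this
  have hψmono : StrictMonoOn ψ (Ioi 0) := fun s hs s' hs' hss => by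
    rw [← hmono.lt_iff_lt (hψr s hs).1 (hψr s' hs').1, (hψr s hs).2, (hψr s' hs').2]
    exact hss
  have himage : ψ '' Ioi 0 = Iint t₀ t₁ := by
    rw [← hrange, image_image]
    exact (image_congr hψl).trans (image_id' _)
  refine ⟨hψmono, fun s hs => ?_⟩
  obtain ⟨hmem, hφψ⟩ := hψr s hs
  have hlt := hsol.mul_flux_lt hg hh ht₀ hcont₀ hmono hpos hmem
  have hode := hsol.Gfun_mul_deriv hg ht₀ hpos hmem
  rw [hφψ] at hlt hode
  have hG : 0 < Gfun g (s ^ 2) := hg.2.2.2.2 _ (pow_pos hs 2)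
  have hφ' : 0 < deriv φ (ψ s) := by
    refine pos_of_mul_pos_right ?_ hG.le
    rw [hode]
    linarith
  have hcont : ContinuousAt ψ s := hψmono.continuousAt_of_image_mem_nhds (Ioi_mem_nhds hs)
    (himage ▸ (isOpen_Iint t₀ t₁).mem_nhds hmem)
  have hφd : HasDerivAt φ (deriv φ (ψ s)) (ψ s) :=
    (hsol.1.differentiableAt ((isOpen_Iint t₀ t₁).mem_nhds hmem)).hasDerivAt
  have hψd : HasDerivAt ψ (deriv φ (ψ s))⁻¹ s :=
    hφd.of_local_left_inverse hcont hφ'.ne' (by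
      filter_upwards [Ioi_mem_nhds hs] with y hy using (hψr y hy).2)
  rw [hψd.deriv]
  refine ⟨inv_pos.2 hφ', hψd, sub_pos.2 hlt, ?_⟩
  rw [← hode]
  field_simp

lemma intervalIntegrable_mul_deriv_of_monotoneOn {c : ℝ} (hψ : MonotoneOn ψ (Ioi 0))
    (hc : ∀ s ∈ Ioi (0 : ℝ), c ≤ ψ s) {s : ℝ} (hs : 0 ≤ s) :
    IntervalIntegrable (fun σ => σ * deriv ψ σ) MeasureTheory.volume 0 s := by
  have hm : MonotoneOn (Function.update ψ 0 c) (uIcc 0 s) := by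
    rw [uIcc_of_le hs]
    intro x hx y hy hxy
    rcases hx.1.eq_or_lt with rfl | hx0
    · rcases hy.1.eq_or_lt with rfl | hy0
      · exact le_rfl
      · rw [Function.update_self, Function.update_of_ne hy0.ne']
        exact hc y hy0
    · have hy0 : 0 < y := hx0.trans_le hxy
      rw [Function.update_of_ne hx0.ne', Function.update_of_ne hy0.ne']
      exact hψ hx0 hy0 hxy
  refine IntervalIntegrable.continuousOn_mul ?_ continuousOn_id
  refine hm.intervalIntegrable_deriv.congr fun x hx => ?_
  rw [uIoc_of_le hs] at hx
  refine EventuallyEq.deriv_eq ?_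
  filter_upwards [Ioi_mem_nhds hx.1] with y hy using Function.update_of_ne (ne_of_gt hy) _ _

/-- The radial data as functions of `ρ = q²`: `m` is `ψ'(q)` and `α` is `q / ψ(q)`. -/
lemma SolOn.exists_profile (hg : Cond24 g) (hh : Cond25 h) (ht₀ : 0 ≤ t₀)
    (hsol : SolOn N g h φ (Iint t₀ t₁)) (hcont₀ : Tendsto φ (𝓝[>] t₀) (𝓝 0))
    (hmono : StrictMonoOn φ (Iint t₀ t₁)) (hrange : φ '' Iint t₀ t₁ = Ioi 0)
    (hψl : ∀ t ∈ Iint t₀ t₁, ψ (φ t) = t)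
    (hψr : ∀ s ∈ Ioi (0 : ℝ), ψ s ∈ Iint t₀ t₁ ∧ φ (ψ s) = s) :
    ∃ m α : ℝ → ℝ, ContDiffOn ℝ 1 m (Ioi 0) ∧ ContDiffOn ℝ 1 α (Ioi 0) ∧ ∀ ρ ∈ Ioi (0 : ℝ),
      0 < m ρ ∧
      HasDerivAt α (α ρ / (2 * ρ) - m ρ * α ρ ^ 2 / (2 * ρ)) ρ ∧
      HasDerivAt (fun r => ∫ s in (0 : ℝ)..√r, s * deriv ψ s) (m ρ / 2) ρ ∧
      m ρ * (h ρ - (N - 1 : ℕ) * (g ρ * α ρ)) = Gfun g ρ := by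
  obtain ⟨hψmono, hψ⟩ := hsol.inverse_properties hg hh ht₀ hcont₀ hmono hrange hψl hψr
  have hψpos : ∀ s ∈ Ioi (0 : ℝ), 0 < ψ s := fun s hs => ht₀.trans_lt (hψr s hs).1.1
  have hsqrt : ∀ ρ ∈ Ioi (0 : ℝ), √ρ ∈ Ioi (0 : ℝ) := fun ρ hρ => Real.sqrt_pos.2 hρ
  set m : ℝ → ℝ := fun ρ => deriv ψ √ρ with hmdef
  set α : ℝ → ℝ := fun ρ => √ρ / ψ √ρ with hαdef
  have hDpos : ∀ ρ ∈ Ioi (0 : ℝ), 0 < h ρ - (N - 1 : ℕ) * (g ρ * α ρ) := fun ρ hρ => by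
    simpa only [Real.sq_sqrt (le_of_lt hρ)] using (hψ _ (hsqrt ρ hρ)).2.2.1
  have hode : ∀ ρ ∈ Ioi (0 : ℝ), m ρ * (h ρ - (N - 1 : ℕ) * (g ρ * α ρ)) = Gfun g ρ :=
    fun ρ hρ => by
      simpa only [Real.sq_sqrt (le_of_lt hρ)] using (hψ _ (hsqrt ρ hρ)).2.2.2
  have hsqd : ∀ ρ ∈ Ioi (0 : ℝ), HasDerivAt Real.sqrt (1 / (2 * √ρ)) ρ := fun ρ hρ =>
    Real.hasDerivAt_sqrt (ne_of_gt hρ)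
  have hαd : ∀ ρ ∈ Ioi (0 : ℝ),
      HasDerivAt α (α ρ / (2 * ρ) - m ρ * α ρ ^ 2 / (2 * ρ)) ρ := fun ρ hρ => by
    have h0 := hsqrt ρ hρ
    have h1 : HasDerivAt (fun ρ => ψ √ρ) (m ρ * (1 / (2 * √ρ))) ρ :=
      (hψ _ h0).2.1.comp ρ (hsqd ρ hρ)
    have h2 := (hsqd ρ hρ).div h1 (hψpos _ h0).ne'
    refine h2.congr_deriv ?_
    have h3 : ψ √ρ ≠ 0 := (hψpos _ h0).ne'
    have h4 : √ρ ≠ 0 := ne_of_gt h0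
    simp only [hαdef]
    generalize m ρ = a
    obtain ⟨r, hr, hr'⟩ : ∃ r, √ρ = r ∧ ρ = r ^ 2 := ⟨_, rfl, (Real.sq_sqrt (le_of_lt hρ)).symm⟩
    rw [hr] at h3 h4 ⊢
    rw [hr']
    field_simp
  have hgC : ContDiffOn ℝ 2 g (Ioi 0) := hg.1.of_le (WithTop.coe_le_coe.2 le_top)
  have hhC : ContDiffOn ℝ 1 h (Ioi 0) :=
    (hh.1.of_le (WithTop.coe_le_coe.2 le_top)).mono Ioi_subset_Ici_self
  have hGC : ContDiffOn ℝ 1 (Gfun g) (Ioi 0) :=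
    (hgC.of_le (by norm_num)).add ((contDiff_const.mul contDiff_id).contDiffOn.mul
      (hgC.deriv_of_isOpen isOpen_Ioi (by norm_num)))
  have hmeq : ∀ ρ ∈ Ioi (0 : ℝ), m ρ = Gfun g ρ / (h ρ - (N - 1 : ℕ) * (g ρ * α ρ)) :=
    fun ρ hρ => by rw [eq_div_iff (hDpos ρ hρ).ne', hode ρ hρ]
  have hmC {k : WithTop ℕ∞} (hk : k ≤ 1) (hα : ContDiffOn ℝ k α (Ioi 0)) :
      ContDiffOn ℝ k m (Ioi 0) := by
    refine ContDiffOn.congr ?_ hmeq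
    exact (hGC.of_le hk).div ((hhC.of_le hk).sub (contDiffOn_const.mul
      ((hgC.of_le (hk.trans (by norm_num))).mul hα))) fun ρ hρ => (hDpos ρ hρ).ne'
  have hα0 : ContDiffOn ℝ 0 α (Ioi 0) :=
    contDiffOn_zero.2 fun ρ hρ => (hαd ρ hρ).continuousAt.continuousWithinAt
  have hm0 : ContinuousOn m (Ioi 0) := (hmC zero_le_one hα0).continuousOn
  have hα1 : ContDiffOn ℝ 1 α (Ioi 0) := by
    rw [← zero_add (1 : WithTop ℕ∞), contDiffOn_succ_iff_deriv_of_isOpen isOpen_Ioi]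
    refine ⟨fun ρ hρ => (hαd ρ hρ).differentiableAt.differentiableWithinAt, by simp, ?_⟩
    rw [contDiffOn_zero]
    refine ContinuousOn.congr ?_ fun ρ hρ => (hαd ρ hρ).deriv
    have h2 : ContinuousOn (fun ρ : ℝ => 2 * ρ) (Ioi 0) := by fun_prop
    have h2' : ∀ ρ ∈ Ioi (0 : ℝ), 2 * ρ ≠ 0 := fun ρ hρ => mul_ne_zero two_ne_zero (ne_of_gt hρ)
    exact (hα0.continuousOn.div h2 h2').sub ((hm0.mul (hα0.continuousOn.pow 2)).div h2 h2')
  refine ⟨m, α, hmC le_rfl hα1, hα1, fun ρ hρ => ⟨(hψ _ (hsqrt ρ hρ)).1, hαd ρ hρ, ?_, hode ρ hρ⟩⟩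
  have h0 := hsqrt ρ hρ
  have hdc : ContinuousOn (fun s => s * deriv ψ s) (Ioi 0) := by
    refine continuousOn_id.mul ?_
    refine (hm0.comp (continuous_pow 2).continuousOn fun s (hs : 0 < s) =>
      mem_Ioi.2 (pow_pos hs 2)).congr fun s hs => ?_
    simp [hmdef, Real.sqrt_sq (le_of_lt hs)]
  have hint := intervalIntegrable_mul_deriv_of_monotoneOn (c := t₀) hψmono.monotoneOn
    (fun s hs => (hψr s hs).1.1.le) (le_of_lt h0)
  have hF := intervalIntegral.integral_hasDerivAt_right hint
    (hdc.stronglyMeasurableAtFilter isOpen_Ioi _ h0) (hdc.continuousAt (Ioi_mem_nhds h0))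
  refine (hF.comp ρ (hsqd ρ hρ)).congr_deriv ?_
  have h4 : √ρ ≠ 0 := ne_of_gt h0
  simp only [hmdef]
  field_simp

end RadialProfile

section DifferentiatedEquation

lemma hasDerivAt_deriv_profile_identity {g h m α : ℝ → ℝ} {n ρ α' : ℝ} (hg : Cond24 g)
    (hh : Cond25 h) (hρ : 0 < ρ) (hm : HasDerivAt m (deriv m ρ) ρ) (hα : HasDerivAt α α' ρ)
    (hode : ∀ r ∈ Ioi (0 : ℝ), m r * (h r - n * (g r * α r)) = Gfun g r) :
    deriv m ρ * (h ρ - n * (g ρ * α ρ)) +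
      m ρ * (deriv h ρ - n * (deriv g ρ * α ρ + g ρ * α')) =
      3 * deriv g ρ + 2 * ρ * deriv (deriv g) ρ := by
  have hgC : ContDiffOn ℝ 2 g (Ioi 0) := hg.1.of_le (WithTop.coe_le_coe.2 le_top)
  have hgd := hg.hasDerivAt hρ
  have hgdd : HasDerivAt (deriv g) (deriv (deriv g) ρ) ρ :=
    (((hgC.deriv_of_isOpen (m := 1) isOpen_Ioi (by norm_num)).contDiffAt
      (Ioi_mem_nhds hρ)).differentiableAt (by simp)).hasDerivAt
  have h1 := hm.mul ((hh.hasDerivAt hρ).sub ((hgd.mul hα).const_mul n))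
  have h2 : HasDerivAt (Gfun g) (3 * deriv g ρ + 2 * ρ * deriv (deriv g) ρ) ρ := by
    refine (hgd.add (((hasDerivAt_id ρ).const_mul 2).mul hgdd)).congr_deriv ?_
    simp
    ring
  refine h1.unique (h2.congr_of_eventuallyEq ?_)
  filter_upwards [Ioi_mem_nhds hρ] with r hr using hode r hr

variable {ι E : Type*} [Fintype ι] [NormedAddCommGroup E] [InnerProductSpace ℝ E]

lemma inner_apply_comm_of_hasFDerivAt_gradient {u : E → ℝ} {V : E → E} {H : E →L[ℝ] E} {x : E}
    (hu : ∀ᶠ y in 𝓝 x, HasFDerivAt u (innerSL ℝ (V y)) y) (hV : HasFDerivAt V H x) (w w' : E) :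
    inner ℝ (H w) w' = inner ℝ w (H w') := by
  have h1 : HasFDerivAt (fun y => innerSL ℝ (V y)) ((innerSL ℝ).comp H) x :=
    (innerSL ℝ).hasFDerivAt.comp x hV
  have h2 := second_derivative_symmetric_of_eventually_of_real hu h1 w w'
  simpa [real_inner_comm] using h2

lemma sum_inner_mul_inner_of_isSymmetric (b : OrthonormalBasis ι ℝ E) {H : E →L[ℝ] E}
    (hH : ∀ w w', inner ℝ (H w) w' = inner ℝ w (H w')) (V : E) :
    ∑ i, inner ℝ V (H (b i)) * inner ℝ V (b i) = inner ℝ V (H V) := by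
  rw [← hH V V, ← b.sum_inner_mul_inner (H V) V]
  exact Finset.sum_congr rfl fun i _ => by rw [hH, real_inner_comm V (b i)]

lemma sum_fderiv_flux (b : OrthonormalBasis ι ℝ E) {g : ℝ → ℝ} {V : E → E} {H : E →L[ℝ] E}
    {g' : ℝ} {x : E} (hg : HasDerivAt g g' (‖V x‖ ^ 2)) (hV : HasFDerivAt V H x)
    (hH : ∀ w w', inner ℝ (H w) w' = inner ℝ w (H w')) :
    ∑ i, fderiv ℝ (fun y => g (‖V y‖ ^ 2) * inner ℝ (V y) (b i)) x (b i) =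
      2 * g' * inner ℝ (V x) (H (V x)) + g (‖V x‖ ^ 2) * ∑ i, inner ℝ (H (b i)) (b i) := by
  have hρ : HasFDerivAt (fun y => ‖V y‖ ^ 2) (2 • (innerSL ℝ (V x)).comp H) x := hV.norm_sq
  have expand (i : ι) : fderiv ℝ (fun y => g (‖V y‖ ^ 2) * inner ℝ (V y) (b i)) x (b i) =
      2 * g' * (inner ℝ (V x) (H (b i)) * inner ℝ (V x) (b i)) +
        g (‖V x‖ ^ 2) * inner ℝ (H (b i)) (b i) := by
    have h1 : HasFDerivAt (fun y => g (‖V y‖ ^ 2)) (g' • 2 • (innerSL ℝ (V x)).comp H) x :=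
      HasDerivAt.comp_hasFDerivAt x hg hρ
    have h2 := h1.fun_mul (hV.inner ℝ (hasFDerivAt_const (b i) x))
    rw [h2.fderiv]
    simp
    ring
  simp only [expand, Finset.sum_add_distrib, ← Finset.mul_sum]
  rw [sum_inner_mul_inner_of_isSymmetric b hH]

lemma differentiated_equation (b : OrthonormalBasis ι ℝ E) {g dg h : ℝ → ℝ} {V : E → E}
    {H : E → E →L[ℝ] E} {T : E →L[ℝ] E →L[ℝ] E} {g'' h' : ℝ} {x : E}
    (hg : HasDerivAt g (dg (‖V x‖ ^ 2)) (‖V x‖ ^ 2)) (hdg : HasDerivAt dg g'' (‖V x‖ ^ 2))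
    (hh : HasDerivAt h h' (‖V x‖ ^ 2)) (hV : HasFDerivAt V (H x) x) (hHT : HasFDerivAt H T x)
    (hH : ∀ w w', inner ℝ (H x w) w' = inner ℝ w (H x w'))
    (hpde : ∀ᶠ y in 𝓝 x, 2 * dg (‖V y‖ ^ 2) * inner ℝ (V y) (H y (V y))
      + g (‖V y‖ ^ 2) * ∑ i, inner ℝ (H y (b i)) (b i) = h (‖V y‖ ^ 2)) :
    4 * g'' * inner ℝ (V x) (H x (V x)) ^ 2
      + 2 * dg (‖V x‖ ^ 2) * (2 * ‖H x (V x)‖ ^ 2 + inner ℝ (V x) (T (V x) (V x)))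
      + 2 * dg (‖V x‖ ^ 2) * inner ℝ (V x) (H x (V x)) * ∑ i, inner ℝ (H x (b i)) (b i)
      + g (‖V x‖ ^ 2) * ∑ i, inner ℝ (T (V x) (b i)) (b i)
      = 2 * h' * inner ℝ (V x) (H x (V x)) := by
  have hρ : HasFDerivAt (fun y => ‖V y‖ ^ 2) (2 • (innerSL ℝ (V x)).comp (H x)) x := hV.norm_sq
  have e1 : HasFDerivAt (fun y => g (‖V y‖ ^ 2)) _ x := HasDerivAt.comp_hasFDerivAt x hg hρ
  have e2 : HasFDerivAt (fun y => dg (‖V y‖ ^ 2)) _ x := HasDerivAt.comp_hasFDerivAt x hdg hρ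
  have e3 : HasFDerivAt (fun y => h (‖V y‖ ^ 2)) _ x := HasDerivAt.comp_hasFDerivAt x hh hρ
  have e4 := hV.inner ℝ (hHT.clm_apply hV)
  have e5 : HasFDerivAt (fun y => ∑ i, inner ℝ (H y (b i)) (b i)) _ x :=
    HasFDerivAt.fun_sum (u := Finset.univ) fun i _ =>
      (hHT.clm_apply (hasFDerivAt_const (b i) x)).inner ℝ (hasFDerivAt_const (b i) x)
  have h1 := ((e2.const_mul 2).mul e4).add (e1.mul e5)
  have h2 := DFunLike.congr_fun (h1.unique (e3.congr_of_eventuallyEq hpde)) (V x)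
  simp [inner_add_right] at h2
  rw [← hH (V x) (H x (V x)), real_inner_self_eq_norm_sq] at h2
  linear_combination h2

end DifferentiatedEquation

section PFunction

variable {ι E : Type*} [Fintype ι] [NormedAddCommGroup E] [InnerProductSpace ℝ E]

lemma hasFDerivAt_pFunction {F u : E → ℝ} {Fr : ℝ → ℝ} {V : E → E} {H : E →L[ℝ] E} {m : ℝ}
    {x : E} (hF : ∀ᶠ y in 𝓝 x, F y = Fr (‖V y‖ ^ 2) - u y)
    (hFr : HasDerivAt Fr (m / 2) (‖V x‖ ^ 2)) (hu : HasFDerivAt u (innerSL ℝ (V x)) x)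
    (hV : HasFDerivAt V H x) (hH : ∀ w w', inner ℝ (H w) w' = inner ℝ w (H w')) :
    HasFDerivAt F (innerSL ℝ (m • H (V x) - V x)) x := by
  have hρ : HasFDerivAt (fun y => ‖V y‖ ^ 2) (2 • (innerSL ℝ (V x)).comp H) x := hV.norm_sq
  have h1 : HasFDerivAt (fun y => Fr (‖V y‖ ^ 2)) _ x := HasDerivAt.comp_hasFDerivAt x hFr hρ
  refine ((h1.sub hu).congr_of_eventuallyEq hF).congr_fderiv ?_
  ext w
  simp [hH]
  ring

lemma hasFDerivAt_gradient_pFunction {m : ℝ → ℝ} {m' : ℝ} {V : E → E} {H : E → E →L[ℝ] E}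
    {T : E →L[ℝ] E →L[ℝ] E} {x : E} (hm : HasDerivAt m m' (‖V x‖ ^ 2))
    (hV : HasFDerivAt V (H x) x) (hHT : HasFDerivAt H T x) :
    HasFDerivAt (fun y => m (‖V y‖ ^ 2) • H y (V y) - V y)
      (((2 * m') • (innerSL ℝ (V x)).comp (H x)).smulRight (H x (V x))
        + m (‖V x‖ ^ 2) • (T.flip (V x) + (H x).comp (H x)) - H x) x := by
  have hρ : HasFDerivAt (fun y => ‖V y‖ ^ 2) (2 • (innerSL ℝ (V x)).comp (H x)) x := hV.norm_sq
  have h1 : HasFDerivAt (fun y => m (‖V y‖ ^ 2)) _ x := HasDerivAt.comp_hasFDerivAt x hm hρ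
  refine ((h1.smul (hHT.clm_apply hV)).sub hV).congr_fderiv ?_
  ext w
  simp
  module

theorem exists_frontier_forall_pFunction_le [FiniteDimensional ℝ E] [Nontrivial E]
    (b : OrthonormalBasis ι ℝ E) {n : ℝ} (hn : (Fintype.card ι : ℝ) = n + 1) {g h : ℝ → ℝ}
    (hg : Cond24 g) (hh : Cond25 h) {m α Fr : ℝ → ℝ} (hm : ContDiffOn ℝ 1 m (Ioi 0))
    (hα : ContDiffOn ℝ 1 α (Ioi 0))
    (hprofile : ∀ ρ ∈ Ioi (0 : ℝ), 0 < m ρ ∧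
      HasDerivAt α (α ρ / (2 * ρ) - m ρ * α ρ ^ 2 / (2 * ρ)) ρ ∧
      HasDerivAt Fr (m ρ / 2) ρ ∧ m ρ * (h ρ - n * (g ρ * α ρ)) = Gfun g ρ)
    {Ω : Set E} (hΩ : IsOpen Ω) (hbdd : Bornology.IsBounded Ω) (hne : Ω.Nonempty)
    {u : E → ℝ} {V : E → E} (hucont : ContinuousOn u (closure Ω))
    (hVcont : ContinuousOn V (closure Ω)) (hV0 : ∀ x ∈ closure Ω, V x ≠ 0)
    (hu : ∀ x ∈ Ω, HasFDerivAt u (innerSL ℝ (V x)) x) (hV : ContDiffOn ℝ 2 V Ω)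
    (hpde : ∀ x ∈ Ω, ∑ i, fderiv ℝ (fun y => g (‖V y‖ ^ 2) * inner ℝ (V y) (b i)) x (b i) =
      h (‖V x‖ ^ 2)) :
    ∃ x₀ ∈ frontier Ω, ∀ x ∈ closure Ω, Fr (‖V x‖ ^ 2) - u x ≤ Fr (‖V x₀‖ ^ 2) - u x₀ := by
  have hρ : ∀ x ∈ closure Ω, ‖V x‖ ^ 2 ∈ Ioi (0 : ℝ) := fun x hx =>
    mem_Ioi.2 (pow_pos (norm_pos_iff.2 (hV0 x hx)) 2)
  have hρΩ : ∀ x ∈ Ω, ‖V x‖ ^ 2 ∈ Ioi (0 : ℝ) := fun x hx => hρ x (subset_closure hx)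
  have hVΩ : ContinuousOn V Ω := hVcont.mono subset_closure
  have hVd : ∀ x ∈ Ω, HasFDerivAt V (fderiv ℝ V x) x := fun x hx =>
    ((hV.contDiffAt (hΩ.mem_nhds hx)).differentiableAt (by simp)).hasFDerivAt
  have hHC : ContDiffOn ℝ 1 (fderiv ℝ V) Ω := hV.fderiv_of_isOpen hΩ (by norm_num)
  have hHd : ∀ x ∈ Ω, HasFDerivAt (fderiv ℝ V) (fderiv ℝ (fderiv ℝ V) x) x := fun x hx =>
    ((hHC.contDiffAt (hΩ.mem_nhds hx)).differentiableAt (by simp)).hasFDerivAt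
  have hmem : ∀ x ∈ Ω, ∀ᶠ y in 𝓝 x, y ∈ Ω := fun x hx => hΩ.mem_nhds hx
  have hsymm : ∀ x ∈ Ω, ∀ w w', inner ℝ (fderiv ℝ V x w) w' = inner ℝ w (fderiv ℝ V x w') :=
    fun x hx => inner_apply_comm_of_hasFDerivAt_gradient ((hmem x hx).mono hu) (hVd x hx)
  have hpde₁ : ∀ x ∈ Ω, 2 * deriv g (‖V x‖ ^ 2) * inner ℝ (V x) (fderiv ℝ V x (V x))
      + g (‖V x‖ ^ 2) * ∑ i, inner ℝ (fderiv ℝ V x (b i)) (b i) = h (‖V x‖ ^ 2) := fun x hx => by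
    rw [← sum_fderiv_flux b (hg.hasDerivAt (hρΩ x hx)) (hVd x hx) (hsymm x hx), hpde x hx]
  have hgC : ContDiffOn ℝ 2 g (Ioi 0) := hg.1.of_le (WithTop.coe_le_coe.2 le_top)
  have hdgC : ContDiffOn ℝ 1 (deriv g) (Ioi 0) := hgC.deriv_of_isOpen isOpen_Ioi (by norm_num)
  have hhC : ContDiffOn ℝ 1 h (Ioi 0) :=
    (hh.1.of_le (WithTop.coe_le_coe.2 le_top)).mono Ioi_subset_Ici_self
  have hdgd : ∀ ρ ∈ Ioi (0 : ℝ), HasDerivAt (deriv g) (deriv (deriv g) ρ) ρ := fun ρ hρ =>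
    ((hdgC.contDiffAt (Ioi_mem_nhds hρ)).differentiableAt (by simp)).hasDerivAt
  have hmd : ∀ ρ ∈ Ioi (0 : ℝ), HasDerivAt m (deriv m ρ) ρ := fun ρ hρ =>
    ((hm.contDiffAt (Ioi_mem_nhds hρ)).differentiableAt (by simp)).hasDerivAt
  have hcomp {f : ℝ → ℝ} (hf : ContinuousOn f (Ioi 0)) :
      ContinuousOn (fun x => f (‖V x‖ ^ 2)) Ω := hf.comp (hVΩ.norm.pow 2) hρΩ
  set v : E → E := fun x => m (‖V x‖ ^ 2) • fderiv ℝ V x (V x) - V x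
  have hvcont : ContinuousOn v Ω :=
    ((hcomp hm.continuousOn).smul (hHC.continuousOn.clm_apply hVΩ)).sub hVΩ
  set cη : ℝ → ℝ := fun ρ => 2 * deriv m ρ * g ρ - 2 * m ρ * deriv g ρ with hcη
  set cκ : ℝ → ℝ := fun ρ => 4 * deriv m ρ * deriv g ρ - 4 * m ρ * deriv (deriv g) ρ
    + 4 * m ρ * deriv g ρ ^ 2 / g ρ with hcκ
  set c : ℝ → ℝ := fun ρ => 2 * m ρ * g ρ * ((1 / m ρ - α ρ) / ρ) + 2 * m ρ * deriv h ρ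
    - 4 * m ρ * α ρ * deriv g ρ - 2 * m ρ * deriv g ρ * h ρ / g ρ with hc
  have hmc := hm.continuousOn
  have hαc := hα.continuousOn
  have hgc := hgC.continuousOn
  have hdgc := hdgC.continuousOn
  have hhc := hhC.continuousOn
  have hm'c := hm.continuousOn_deriv_of_isOpen isOpen_Ioi le_rfl
  have hg''c := hdgC.continuousOn_deriv_of_isOpen isOpen_Ioi le_rfl
  have hh'c := hhC.continuousOn_deriv_of_isOpen isOpen_Ioi le_rfl
  have hm0 : ∀ ρ ∈ Ioi (0 : ℝ), m ρ ≠ 0 := fun ρ hρ => (hprofile ρ hρ).1.ne'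
  have hg0 : ∀ ρ ∈ Ioi (0 : ℝ), g ρ ≠ 0 := fun ρ hρ => (hg.2.1 ρ hρ).ne'
  have hid0 : ∀ ρ ∈ Ioi (0 : ℝ), ρ ≠ 0 := fun ρ hρ => ne_of_gt hρ
  have hm20 : ∀ ρ ∈ Ioi (0 : ℝ), m ρ ^ 2 ≠ 0 := fun ρ hρ => pow_ne_zero 2 (hm0 ρ hρ)
  have hη : ContinuousOn (fun ρ => cη ρ / m ρ ^ 2) (Ioi 0) := by
    fun_prop (disch := assumption)
  have hκ : ContinuousOn (fun ρ => cκ ρ / m ρ ^ 2) (Ioi 0) := by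
    fun_prop (disch := assumption)
  have hcm : ContinuousOn (fun ρ => c ρ / m ρ) (Ioi 0) := by
    fun_prop (disch := assumption)
  set B : E → E := fun x =>
    (2 * (cη (‖V x‖ ^ 2) / m (‖V x‖ ^ 2) ^ 2)
      + cκ (‖V x‖ ^ 2) / m (‖V x‖ ^ 2) ^ 2 * (2 * ‖V x‖ ^ 2 + inner ℝ (V x) (v x))
      + c (‖V x‖ ^ 2) / m (‖V x‖ ^ 2)) • V x
    + (cη (‖V x‖ ^ 2) / m (‖V x‖ ^ 2) ^ 2) • v x with hB
  have hBcont : ContinuousOn B Ω := by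
    have h1 := hcomp hη
    have h2 := hcomp hκ
    have h3 := hcomp hcm
    have h4 : ContinuousOn (fun x => inner ℝ (V x) (v x)) Ω := hVΩ.inner hvcont
    have h5 : ContinuousOn (fun x => ‖V x‖ ^ 2) Ω := hVΩ.norm.pow 2
    exact ((((h1.const_smul (2 : ℝ)).add (h2.mul ((h5.const_smul (2 : ℝ)).add h4))).add
      h3).smul hVΩ).add (h1.smul hvcont)
  have hFrc : ContinuousOn Fr (Ioi 0) := fun ρ hρ =>
    (hprofile ρ hρ).2.2.1.continuousAt.continuousWithinAt
  refine exists_frontier_forall_le_of_elliptic b hΩ hbdd hne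
    (P := fun x => Fr (‖V x‖ ^ 2) - u x) (v := v) (V := V) (β := fun x => ‖B x‖)
    (c₁ := fun x => g (‖V x‖ ^ 2)) (c₂ := fun x => 2 * deriv g (‖V x‖ ^ 2))
    ((hFrc.comp (hVcont.norm.pow 2) hρ).sub hucont)
    (fun x hx => hasFDerivAt_pFunction (Eventually.of_forall fun _ => rfl)
      (hprofile _ (hρΩ x hx)).2.2.1 (hu x hx) (hVd x hx) (hsymm x hx))
    (fun x hx => hasFDerivAt_gradient_pFunction (hmd _ (hρΩ x hx)) (hVd x hx) (hHd x hx))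
    hVΩ (hcomp hgc) ((hcomp hdgc).const_smul (2 : ℝ)) hBcont.norm
    (fun x hx => hg.2.1 _ (hρΩ x hx)) (fun x hx => ?_) (fun x hx => ?_)
  · have := hg.2.2.2.2 _ (hρΩ x hx)
    rw [Gfun] at this
    linarith
  · obtain ⟨hmpos, hαd, -, hode⟩ := hprofile _ (hρΩ x hx)
    have hode' := hasDerivAt_deriv_profile_identity hg hh (hρΩ x hx) (hmd _ (hρΩ x hx)) hαd
      fun ρ hρ => (hprofile ρ hρ).2.2.2
    have hpde' := differentiated_equation b (hg.hasDerivAt (hρΩ x hx)) (hdgd _ (hρΩ x hx))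
      (hh.hasDerivAt (hρΩ x hx)) (hVd x hx) (hHd x hx) (hsymm x hx) ((hmem x hx).mono hpde₁)
    have hTsymm : ∀ w w', fderiv ℝ (fderiv ℝ V) x w w' = fderiv ℝ (fderiv ℝ V) x w' w :=
      fun w w' => second_derivative_symmetric_of_eventually_of_real ((hmem x hx).mono hVd)
        (hHd x hx) w w'
    have key := elliptic_inequality b (v := v x)
      (W := ((2 * deriv m (‖V x‖ ^ 2)) • (innerSL ℝ (V x)).comp (fderiv ℝ V x)).smulRight
          (fderiv ℝ V x (V x))
        + m (‖V x‖ ^ 2) • ((fderiv ℝ (fderiv ℝ V) x).flip (V x)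
          + (fderiv ℝ V x).comp (fderiv ℝ V x)) - fderiv ℝ V x) (hsymm x hx)
      hTsymm rfl (fun w => by simp) hn
      (hg.2.1 _ (hρΩ x hx)) hmpos (hV0 x (subset_closure hx)) rfl hode hode' (hpde₁ x hx) hpde'
    refine le_trans ?_ key
    refine (neg_le_of_abs_le (abs_real_inner_le_norm (B x) (v x))).trans_eq ?_
    simp only [hB, inner_add_left, inner_smul_left, conj_trivial, real_inner_self_eq_norm_sq]
    ring

end PFunction

/-- First part of the paper's Theorem 2.1: under (2.4), (2.5), with `φ` the solution
of (2.6) on its maximal interval `(t₀, t₁)` with `φ(t₀) = 0` and `ψ` the inverse of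
`φ`, if `u` solves `(g(q²)uᵢ)ᵢ = h(q²)` on a bounded open `Ω` with `u`, `∇u`
continuous up to the boundary and `q = |∇u| > 0` on the closure, then
`Φ = ∫₀^q s ψ'(s) ds − u` attains its maximum over `closure Ω` on the boundary. -/
theorem stmt6 (N : ℕ) (hN : 1 ≤ N) (g h : ℝ → ℝ) (hg : Cond24 g) (hh : Cond25 h)
    (t₀ : ℝ) (ht₀ : 0 ≤ t₀) (t₁ : EReal) (ht₁ : (t₀ : EReal) < t₁)
    (φ ψ : ℝ → ℝ)
    (hsol : SolOn N g h φ (Iint t₀ t₁))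
    (hcont₀ : Tendsto φ (nhdsWithin t₀ (Ioi t₀)) (nhds 0))
    (hmono : StrictMonoOn φ (Iint t₀ t₁))
    (hrange : φ '' (Iint t₀ t₁) = Ioi 0)
    (hψl : ∀ t ∈ Iint t₀ t₁, ψ (φ t) = t)
    (hψr : ∀ s ∈ Ioi (0:ℝ), ψ s ∈ Iint t₀ t₁ ∧ φ (ψ s) = s)
    (Ω : Set (EuclideanSpace ℝ (Fin N))) (hΩ : IsOpen Ω)
    (hbdd : Bornology.IsBounded Ω) (hne : Ω.Nonempty)
    (u : EuclideanSpace ℝ (Fin N) → ℝ) (hu : ContDiffOn ℝ 3 u Ω)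
    (hucont : ContinuousOn u (closure Ω))
    -- `Gr` is the continuous extension of `∇u` to the closure of `Ω`
    (Gr : EuclideanSpace ℝ (Fin N) → EuclideanSpace ℝ (Fin N))
    (hGrcont : ContinuousOn Gr (closure Ω))
    (hGr : ∀ x ∈ Ω, Gr x = gradient u x)
    (hqpos : ∀ x ∈ closure Ω, 0 < ‖Gr x‖)
    (hpde : ∀ x ∈ Ω,
      ∑ i, fderiv ℝ (fun y => g (‖gradient u y‖ ^ 2) * fderiv ℝ u y (eb N i)) x (eb N i)
        = h (‖gradient u x‖ ^ 2)) :
    ∃ x₀ ∈ frontier Ω, ∀ x ∈ closure Ω,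
      (∫ s in (0:ℝ)..‖Gr x‖, s * deriv ψ s) - u x ≤
      (∫ s in (0:ℝ)..‖Gr x₀‖, s * deriv ψ s) - u x₀ := by
  have : Nonempty (Fin N) := ⟨⟨0, hN⟩⟩
  set b := EuclideanSpace.basisFun (Fin N) ℝ
  have hbi (i : Fin N) : eb N i = b i := (EuclideanSpace.basisFun_apply (Fin N) ℝ i).symm
  obtain ⟨m, α, hm, hα, hprofile⟩ :=
    hsol.exists_profile hg hh ht₀ hcont₀ hmono hrange hψl hψr
  have hn : (Fintype.card (Fin N) : ℝ) = (N - 1 : ℕ) + 1 := by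
    rw [Fintype.card_fin, Nat.cast_sub hN, Nat.cast_one, sub_add_cancel]
  have hud : ∀ x ∈ Ω, DifferentiableAt ℝ u x := fun x hx =>
    (hu.contDiffAt (hΩ.mem_nhds hx)).differentiableAt (by simp)
  have hinner : ∀ x ∈ Ω, ∀ w, inner ℝ (Gr x) w = fderiv ℝ u x w := fun x hx w => by
    rw [hGr x hx, gradient, InnerProductSpace.toDual_symm_apply]
  have hGrC : ContDiffOn ℝ 2 Gr Ω :=
    ((InnerProductSpace.toDual ℝ _).symm.contDiff.comp_contDiffOn
      (hu.fderiv_of_isOpen hΩ (m := 2) (by norm_num))).congr hGr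
  obtain ⟨x₀, hx₀, hmax⟩ := exists_frontier_forall_pFunction_le b hn hg hh hm hα hprofile hΩ hbdd
    hne hucont hGrcont (fun x hx => norm_pos_iff.1 (hqpos x hx))
    (fun x hx => (hud x hx).hasFDerivAt.congr_fderiv (by ext w; simp [hinner x hx])) hGrC
    (fun x hx => by
      rw [hGr x hx, ← hpde x hx]
      refine Finset.sum_congr rfl fun i _ => ?_
      rw [hbi]
      congr 1
      refine EventuallyEq.fderiv_eq ?_
      filter_upwards [hΩ.mem_nhds hx] with y hy
      rw [hinner y hy, hGr y hy])
  refine ⟨x₀, hx₀, fun x hx => ?_⟩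
  simpa only [Real.sqrt_sq (norm_nonneg _)] using hmax x hx

end
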